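/- Let X be a Poisson random variable with mean m > 0. Then the mean absolute deviation of X from its mean satisfies E|X − m| = 2·e^{-m}·m^{⌊m⌋+1}/⌊m⌋!, where ⌊·⌋ denotes the floor function. -/

import Mathlib

/-- The Poisson probability mass at `j` for a Poisson distribution with mean `m`:
`P(X = j) = e^{-m} m^j / j!`. -/
noncomputable def poissonWeight (m : ℝ) (j : ℕ) : ℝ :=
  Real.exp (-m) * m ^ j / (Nat.factorial j : ℝ)

lemma succ_mul_poissonWeight_succ (m : ℝ) (j : ℕ) :
    ((j + 1 : ℕ) : ℝ) * poissonWeight m (j + 1) = m * poissonWeight m j := by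
  unfold poissonWeight
  rw [Nat.factorial_succ]
  push_cast
  field_simp
  ring

lemma poissonWeight_nonneg {m : ℝ} (hm : 0 ≤ m) (j : ℕ) : 0 ≤ poissonWeight m j := by
  unfold poissonWeight
  positivity

lemma tendsto_poissonWeight (m : ℝ) :
    Filter.Tendsto (poissonWeight m) Filter.atTop (nhds 0) := by
  unfold poissonWeight
  simpa [mul_div_assoc] using
    (FloorSemiring.tendsto_pow_div_factorial_atTop m).const_mul (Real.exp (-m))

/-- The sum telescopes, since `(m - j) P(X = j) = (j + 1) P(X = j + 1) - j P(X = j)`. -/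
lemma sum_range_abs_sub_mul_poissonWeight_of_le {m : ℝ} {n : ℕ} (hn : (n : ℝ) ≤ m + 1) :
    ∑ j ∈ Finset.range n, |(j : ℝ) - m| * poissonWeight m j = n * poissonWeight m n := by
  induction n with
  | zero => simp
  | succ n ih =>
    have h : (n : ℝ) ≤ m := by push_cast at hn; linarith
    rw [Finset.sum_range_succ, ih (by linarith), succ_mul_poissonWeight_succ,
      abs_of_nonpos (by linarith)]
    ring

lemma sum_range_abs_sub_mul_poissonWeight {m : ℝ} (hm : 0 ≤ m) (N : ℕ) :
    ∑ j ∈ Finset.range (N + (⌊m⌋₊ + 1)), |(j : ℝ) - m| * poissonWeight m j =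
      2 * (m * poissonWeight m ⌊m⌋₊) - m * poissonWeight m (N + ⌊m⌋₊) := by
  induction N with
  | zero =>
    have h : ((⌊m⌋₊ + 1 : ℕ) : ℝ) ≤ m + 1 := by
      push_cast
      linarith [Nat.floor_le hm]
    rw [zero_add, sum_range_abs_sub_mul_poissonWeight_of_le h, succ_mul_poissonWeight_succ,
      zero_add]
    ring
  | succ N ih =>
    have h : m ≤ ((N + ⌊m⌋₊ + 1 : ℕ) : ℝ) := by
      push_cast
      linarith [Nat.lt_floor_add_one m, (Nat.cast_nonneg N : (0 : ℝ) ≤ N)]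
    rw [show N + 1 + (⌊m⌋₊ + 1) = N + (⌊m⌋₊ + 1) + 1 by ring, Finset.sum_range_succ, ih,
      ← succ_mul_poissonWeight_succ m (N + ⌊m⌋₊),
      show N + (⌊m⌋₊ + 1) = N + ⌊m⌋₊ + 1 by ring,
      show N + 1 + ⌊m⌋₊ = N + ⌊m⌋₊ + 1 by ring, abs_of_nonneg (by linarith)]
    ring

lemma hasSum_abs_sub_mul_poissonWeight {m : ℝ} (hm : 0 ≤ m) :
    HasSum (fun j : ℕ => |(j : ℝ) - m| * poissonWeight m j)
      (2 * (m * poissonWeight m ⌊m⌋₊)) := by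
  rw [hasSum_iff_tendsto_nat_of_nonneg
    fun j => mul_nonneg (abs_nonneg _) (poissonWeight_nonneg hm j),
    ← Filter.tendsto_add_atTop_iff_nat (⌊m⌋₊ + 1)]
  simp_rw [sum_range_abs_sub_mul_poissonWeight hm]
  simpa using (((Filter.tendsto_add_atTop_iff_nat ⌊m⌋₊).2
    (tendsto_poissonWeight m)).const_mul m).const_sub (2 * (m * poissonWeight m ⌊m⌋₊))

/-- For a Poisson random variable `X` with mean `m > 0`, the mean absolute
deviation from the mean is `E|X − m| = 2·e^{-m}·m^{⌊m⌋+1}/⌊m⌋!`. -/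
theorem poisson_mean_absolute_deviation
    (m : ℝ) (hm : 0 < m) :
    (∑' j : ℕ, |(j : ℝ) - m| * poissonWeight m j) =
      2 * Real.exp (-m) * m ^ (⌊m⌋₊ + 1) / (Nat.factorial ⌊m⌋₊ : ℝ) := by
  rw [(hasSum_abs_sub_mul_poissonWeight hm.le).tsum_eq, poissonWeight]
  ring
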